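/- (Grünbaum-type consequence) Let K ⊆ ℝ^d be a compact convex set of positive volume with centroid c, and let H = {x : ⟨a, x − c⟩ ≤ 0} for a nonzero vector a. Then vol(K ∩ H) ≥ (1/e)·vol(K). -/

import Mathlib

open MeasureTheory
open scoped RealInnerProductSpace
open scoped ENNReal Pointwise

/-- The one-dimensional Brunn–Minkowski inequality. -/
theorem Real.add_volume_le_of_add_mem {A B C : Set ℝ} (hA : MeasurableSet A) (hB : MeasurableSet B)
    (hA' : A.Nonempty) (hB' : B.Nonempty) (h : ∀ x ∈ A, ∀ y ∈ B, x + y ∈ C) :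
    volume A + volume B ≤ volume C := by
  obtain ⟨a, ha⟩ := hA'
  obtain ⟨b, hb⟩ := hB'
  rw [hA.measure_eq_iSup_isCompact, hB.measure_eq_iSup_isCompact]
  simp only [iSup_and']
  refine ENNReal.biSup_add_biSup_le' ⟨∅, by simp⟩ ⟨∅, by simp⟩ ?_
  rintro P ⟨hPA, hP⟩ Q ⟨hQB, hQ⟩
  have hP1 := hP.insert a
  have hQ1 := hQ.insert b
  obtain ⟨p, hpP, hp⟩ := hP1.exists_isGreatest (Set.insert_nonempty a P)
  obtain ⟨q, hqQ, hq⟩ := hQ1.exists_isLeast (Set.insert_nonempty b Q)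
  have hPA' : insert a P ⊆ A := Set.insert_subset ha hPA
  have hQB' : insert b Q ⊆ B := Set.insert_subset hb hQB
  have hdisj :
      AEDisjoint volume ((fun x => q + x) '' insert a P) ((fun x => p + x) '' insert b Q) := by
    refine measure_mono_null (t := {p + q}) ?_ (by simp)
    rintro _ ⟨⟨x, hx, rfl⟩, ⟨y, hy, hxy⟩⟩
    have := hp hx
    have := hq hy
    simp only at hxy
    simp only [Set.mem_singleton_iff]
    linarith
  calc volume P + volume Q ≤ volume (insert a P) + volume (insert b Q) :=
        add_le_add (measure_mono (Set.subset_insert _ _)) (measure_mono (Set.subset_insert _ _))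
    _ = volume (((fun x => q + x) '' insert a P) ∪ ((fun x => p + x) '' insert b Q)) := by
        rw [measure_union₀' _ hdisj]
        · simp
        · exact (hP1.image (by fun_prop)).measurableSet.nullMeasurableSet
    _ ≤ volume C := by
        refine measure_mono (Set.union_subset ?_ ?_)
        · rintro _ ⟨x, hx, rfl⟩
          simpa [add_comm] using h x (hPA' hx) q (hQB' hqQ)
        · rintro _ ⟨x, hx, rfl⟩
          exact h p (hPA' hpP) x (hQB' hx)

theorem MeasureTheory.lintegral_eq_lintegral_meas_ofReal_le {α : Type*} [MeasurableSpace α]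
    (μ : Measure α) [SFinite μ] {f : α → ℝ≥0∞} (hf : Measurable f) :
    ∫⁻ x, f x ∂μ = ∫⁻ t in Set.Ioi (0 : ℝ), μ {x | ENNReal.ofReal t ≤ f x} := by
  have hS : MeasurableSet {p : α × ℝ | ENNReal.ofReal p.2 ≤ f p.1} :=
    measurableSet_le (by fun_prop) (by fun_prop)
  have key (y : ℝ≥0∞) :
      ∫⁻ t in Set.Ioi (0 : ℝ), ({t : ℝ | ENNReal.ofReal t ≤ y}).indicator 1 t = y := by
    rw [lintegral_indicator_one (measurableSet_le (by fun_prop) (by fun_prop)),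
      Measure.restrict_apply (measurableSet_le (by fun_prop) (by fun_prop))]
    induction y with
    | top => simp
    | coe y =>
      have : {t : ℝ | ENNReal.ofReal t ≤ (y : ℝ≥0∞)} ∩ Set.Ioi 0 = Set.Ioc 0 (y : ℝ) := by
        ext t
        simp [ENNReal.ofReal, Real.toNNReal_le_iff_le_coe, and_comm]
      rw [this]
      simp
  calc ∫⁻ x, f x ∂μ = ∫⁻ x, (∫⁻ t in Set.Ioi (0 : ℝ),
        ({p : α × ℝ | ENNReal.ofReal p.2 ≤ f p.1}).indicator (1 : α × ℝ → ℝ≥0∞) (x, t)) ∂μ := by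
        refine lintegral_congr fun x => ?_
        exact (key (f x)).symm
    _ = ∫⁻ t in Set.Ioi (0 : ℝ), ∫⁻ x,
        ({p : α × ℝ | ENNReal.ofReal p.2 ≤ f p.1}).indicator (1 : α × ℝ → ℝ≥0∞) (x, t) ∂μ :=
        lintegral_lintegral_swap (f := fun x t =>
          ({p : α × ℝ | ENNReal.ofReal p.2 ≤ f p.1}).indicator (1 : α × ℝ → ℝ≥0∞) (x, t))
          ((measurable_one.indicator hS).aemeasurable)
    _ = _ := by
        refine lintegral_congr fun t => ?_
        exact lintegral_indicator_one (measurableSet_le (by fun_prop) hf)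

theorem ENNReal.geom_mean_le_arith_mean2 {p q : ℝ} (hp : 0 < p) (hq : 0 < q) (hpq : p + q = 1)
    (a b : ℝ≥0∞) : a ^ p * b ^ q ≤ ENNReal.ofReal p * a + ENNReal.ofReal q * b := by
  rcases eq_or_ne a ∞ with rfl | ha
  · simp [ENNReal.mul_top, hp]
  rcases eq_or_ne b ∞ with rfl | hb
  · simp [ENNReal.mul_top, hq]
  lift a to NNReal using ha
  lift b to NNReal using hb
  lift p to NNReal using hp.le
  lift q to NNReal using hq.le
  have := NNReal.geom_mean_le_arith_mean2_weighted p q a b (by exact_mod_cast hpq)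
  rw [ENNReal.ofReal_coe_nnreal, ENNReal.ofReal_coe_nnreal,
    ← ENNReal.coe_rpow_of_nonneg _ p.coe_nonneg, ← ENNReal.coe_rpow_of_nonneg _ q.coe_nonneg]
  exact_mod_cast this

/-- The Prékopa–Leindler inequality with weights `p`, `q`, as a property of the measure `μ`. -/
def PrekopaLeindler {E : Type*} [AddCommGroup E] [Module ℝ E] [MeasurableSpace E] (μ : Measure E)
    (p q : ℝ) : Prop :=
  ∀ f g h : E → ℝ≥0∞, Measurable f → Measurable g → Measurable h →
    (∀ x y, f x ^ p * g y ^ q ≤ h (p • x + q • y)) →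
    (∫⁻ x, f x ∂μ) ^ p * (∫⁻ x, g x ∂μ) ^ q ≤ ∫⁻ x, h x ∂μ

namespace PrekopaLeindler

theorem volume_add_le_of_smul_add_mem {p q : ℝ} (hp : 0 < p) (hq : 0 < q)
    {A B C : Set ℝ} (hA : MeasurableSet A) (hB : MeasurableSet B)
    (hA' : A.Nonempty) (hB' : B.Nonempty) (h : ∀ x ∈ A, ∀ y ∈ B, p • x + q • y ∈ C) :
    ENNReal.ofReal p * volume A + ENNReal.ofReal q * volume B ≤ volume C := by
  have := Real.add_volume_le_of_add_mem (C := C) (hA.const_smul₀ p) (hB.const_smul₀ q)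
    hA'.smul_set hB'.smul_set (by
      rintro _ ⟨x, hx, rfl⟩ _ ⟨y, hy, rfl⟩
      exact h x hx y hy)
  simpa [Measure.addHaar_smul, abs_of_pos hp, abs_of_pos hq] using this

theorem lintegral_add_le_of_iSup_eq_one {p q : ℝ} (hp : 0 < p) (hq : 0 < q) (hpq : p + q = 1)
    {f g h : ℝ → ℝ≥0∞} (hf : Measurable f) (hg : Measurable g)
    (hh : Measurable h) (hfs : ⨆ x, f x = 1) (hgs : ⨆ x, g x = 1)
    (H : ∀ x y, f x ^ p * g y ^ q ≤ h (p • x + q • y)) :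
    ENNReal.ofReal p * (∫⁻ x, f x) + ENNReal.ofReal q * (∫⁻ x, g x) ≤ ∫⁻ x, h x := by
  rw [lintegral_eq_lintegral_meas_ofReal_le _ hf, lintegral_eq_lintegral_meas_ofReal_le _ hg,
    lintegral_eq_lintegral_meas_ofReal_le _ hh]
  have hmeas (f : ℝ → ℝ≥0∞) : Measurable fun t : ℝ => volume {x | ENNReal.ofReal t ≤ f x} :=
    Antitone.measurable fun s t hst => measure_mono fun x hx =>
      (ENNReal.ofReal_le_ofReal hst).trans hx
  rw [← lintegral_const_mul _ (hmeas f), ← lintegral_const_mul _ (hmeas g),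
    ← lintegral_add_left ((hmeas f).const_mul _)]
  refine setLIntegral_mono_ae' measurableSet_Ioi ?_
  have h1 : ∀ᵐ t : ℝ, t ≠ 1 := by simp [ae_iff]
  filter_upwards [h1] with t ht1 ht0
  rcases lt_or_gt_of_ne ht1 with ht | ht
  · have ht' : ENNReal.ofReal t < 1 := by simpa using ht
    obtain ⟨x, hx⟩ := lt_iSup_iff.1 (hfs ▸ ht')
    obtain ⟨y, hy⟩ := lt_iSup_iff.1 (hgs ▸ ht')
    refine volume_add_le_of_smul_add_mem hp hq (measurableSet_le (by fun_prop) hf)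
      (measurableSet_le (by fun_prop) hg) ⟨x, hx.le⟩ ⟨y, hy.le⟩ fun x hx y hy => ?_
    refine le_trans ?_ (H x y)
    calc ENNReal.ofReal t = ENNReal.ofReal t ^ p * ENNReal.ofReal t ^ q := by
          rw [← ENNReal.rpow_add_of_nonneg _ _ hp.le hq.le, hpq, ENNReal.rpow_one]
      _ ≤ f x ^ p * g y ^ q :=
          mul_le_mul' (ENNReal.rpow_le_rpow hx hp.le) (ENNReal.rpow_le_rpow hy hq.le)
  · have ht' : 1 < ENNReal.ofReal t := by simpa using ht
    have aux (f : ℝ → ℝ≥0∞) (hfs : ⨆ x, f x = 1) : {x | ENNReal.ofReal t ≤ f x} = ∅ := by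
      ext x
      simpa using (hfs ▸ le_iSup f x : f x ≤ 1).trans_lt ht'
    simp [aux f hfs, aux g hgs]

theorem volume_real_of_bounded {p q : ℝ} (hp : 0 < p) (hq : 0 < q) (hpq : p + q = 1)
    {f g h : ℝ → ℝ≥0∞} (hf : Measurable f) (hg : Measurable g)
    (hh : Measurable h) (hfs : ⨆ x, f x ≠ ∞) (hgs : ⨆ x, g x ≠ ∞)
    (H : ∀ x y, f x ^ p * g y ^ q ≤ h (p • x + q • y)) :
    (∫⁻ x, f x) ^ p * (∫⁻ x, g x) ^ q ≤ ∫⁻ x, h x := by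
  set M := ⨆ x, f x with hM
  set N := ⨆ x, g x with hN
  rcases eq_or_ne M 0 with hM0 | hM0
  · have : f = 0 := by
      ext x
      simpa [← hM, hM0] using le_iSup f x
    simp [this, hp]
  rcases eq_or_ne N 0 with hN0 | hN0
  · have : g = 0 := by
      ext x
      simpa [← hN, hN0] using le_iSup g x
    simp [this, hq]
  set c := (M ^ p)⁻¹ * (N ^ q)⁻¹ with hc
  have hMp : M ^ p ≠ 0 := by simp [ENNReal.rpow_eq_zero_iff, hM0, hfs]
  have hMp' : M ^ p ≠ ∞ := ENNReal.rpow_ne_top_of_nonneg hp.le hfs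
  have hNq : N ^ q ≠ 0 := by simp [ENNReal.rpow_eq_zero_iff, hN0, hgs]
  have hNq' : N ^ q ≠ ∞ := ENNReal.rpow_ne_top_of_nonneg hq.le hgs
  have hc0 : c ≠ 0 := by simp [hc, hMp', hNq']
  have hct : c ≠ ∞ := ENNReal.mul_ne_top (ENNReal.inv_ne_top.2 hMp) (ENNReal.inv_ne_top.2 hNq)
  have scale (a b : ℝ≥0∞) : (a * M⁻¹) ^ p * (b * N⁻¹) ^ q = a ^ p * b ^ q * c := by
    rw [ENNReal.mul_rpow_of_nonneg _ _ hp.le, ENNReal.mul_rpow_of_nonneg _ _ hq.le,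
      ENNReal.inv_rpow, ENNReal.inv_rpow, hc]
    ring
  have key := lintegral_add_le_of_iSup_eq_one hp hq hpq (hf.mul_const M⁻¹) (hg.mul_const N⁻¹)
    (hh.mul_const c) (by rw [← ENNReal.iSup_mul, ← hM, ENNReal.mul_inv_cancel hM0 hfs])
    (by rw [← ENNReal.iSup_mul, ← hN, ENNReal.mul_inv_cancel hN0 hgs])
    (fun x y => by rw [scale]; gcongr; exact H x y)
  rw [lintegral_mul_const _ hf, lintegral_mul_const _ hg, lintegral_mul_const _ hh] at key
  have := (ENNReal.geom_mean_le_arith_mean2 hp hq hpq _ _).trans key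
  rw [scale] at this
  exact (ENNReal.mul_le_mul_iff_left hc0 hct).1 this

theorem lintegral_eq_iSup_min {α : Type*} [MeasurableSpace α] (μ : Measure α) {f : α → ℝ≥0∞}
    (hf : Measurable f) : ∫⁻ x, f x ∂μ = ⨆ n : ℕ, ∫⁻ x, min (f x) n ∂μ := by
  rw [← lintegral_iSup (fun n => by fun_prop) fun m n hmn x => by dsimp only; gcongr]
  refine lintegral_congr fun x => ?_
  rw [← inf_iSup_eq, ENNReal.iSup_natCast, inf_top_eq]

theorem volume_real {p q : ℝ} (hp : 0 < p) (hq : 0 < q) (hpq : p + q = 1)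
    : PrekopaLeindler (volume : Measure ℝ) p q := by
  intro f g h hf hg hh H
  have aux {r : ℝ} (hr : 0 < r) (u : ℕ → ℝ≥0∞) : (⨆ n, u n) ^ r = ⨆ n, u n ^ r :=
    (ENNReal.orderIsoRpow r hr).map_iSup u
  have bdd (f : ℝ → ℝ≥0∞) (n : ℕ) : ⨆ x, min (f x) n ≠ ∞ :=
    ((iSup_le fun x => min_le_right _ _).trans_lt (ENNReal.natCast_lt_top n)).ne
  rw [lintegral_eq_iSup_min _ hf, lintegral_eq_iSup_min _ hg, aux hp, aux hq, ENNReal.iSup_mul]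
  simp only [ENNReal.mul_iSup]
  refine iSup_le fun m => iSup_le fun n => ?_
  refine volume_real_of_bounded hp hq hpq (by fun_prop) (by fun_prop) hh (bdd f m) (bdd g n)
    fun x y => le_trans ?_ (H x y)
  gcongr <;> exact min_le_left _ _

variable {E F : Type*} [AddCommGroup E] [Module ℝ E] [MeasurableSpace E]
  [AddCommGroup F] [Module ℝ F] [MeasurableSpace F] {μ : Measure E} {ν : Measure F} {p q : ℝ}

theorem prod [SFinite μ] [SFinite ν] (hμ : PrekopaLeindler μ p q) (hν : PrekopaLeindler ν p q) :
    PrekopaLeindler (μ.prod ν) p q := by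
  intro f g h hf hg hh H
  rw [lintegral_prod _ hf.aemeasurable, lintegral_prod _ hg.aemeasurable,
    lintegral_prod _ hh.aemeasurable]
  refine hμ _ _ _ hf.lintegral_prod_right' hg.lintegral_prod_right' hh.lintegral_prod_right'
    fun x y => ?_
  exact hν _ _ _ (by fun_prop) (by fun_prop) (by fun_prop) fun z w => H (x, z) (y, w)

theorem of_measurePreserving (e : E →ₗ[ℝ] F) (he : MeasurePreserving e μ ν)
    (hμ : PrekopaLeindler μ p q) : PrekopaLeindler ν p q := by
  intro f g h hf hg hh H
  rw [← he.lintegral_comp hf, ← he.lintegral_comp hg, ← he.lintegral_comp hh]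
  refine hμ _ _ _ (hf.comp he.measurable) (hg.comp he.measurable) (hh.comp he.measurable)
    fun x y => ?_
  simpa using H (e x) (e y)

theorem volume_pi (hp : 0 < p) (hq : 0 < q) (hpq : p + q = 1) (n : ℕ) :
    PrekopaLeindler (volume : Measure (Fin n → ℝ)) p q := by
  induction n with
  | zero =>
    intro f g h hf hg hh H
    have := H default default
    rw [Subsingleton.elim (p • _ + q • _) default] at this
    simp only [MeasureTheory.volume_pi, Measure.pi_of_empty _ default, lintegral_dirac]
    exact this
  | succ n ih =>
    exact ((volume_real hp hq hpq).prod ih).of_measurePreserving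
      (Fin.consLinearEquiv ℝ (fun _ : Fin (n + 1) => ℝ)).toLinearMap
      (by
        convert! (volume_preserving_piFinSuccAbove (fun _ : Fin (n + 1) => ℝ) 0).symm using 1
        ext x i
        simp [MeasurableEquiv.piFinSuccAbove])

theorem volume_euclideanSpace (hp : 0 < p) (hq : 0 < q) (hpq : p + q = 1) (n : ℕ) :
    PrekopaLeindler (volume : Measure (EuclideanSpace ℝ (Fin n))) p q :=
  (volume_pi hp hq hpq n).of_measurePreserving
    (WithLp.linearEquiv 2 ℝ (Fin n → ℝ)).symm.toLinearMap
    (PiLp.volume_preserving_toLp (Fin n))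

/-- The multiplicative Brunn–Minkowski inequality. -/
theorem measure_rpow_mul_le (hp : 0 < p) (hq : 0 < q) (hμ : PrekopaLeindler μ p q) {A B C : Set E}
    (hA : MeasurableSet A) (hB : MeasurableSet B) (hC : MeasurableSet C)
    (H : ∀ x ∈ A, ∀ y ∈ B, p • x + q • y ∈ C) : μ A ^ p * μ B ^ q ≤ μ C := by
  have := hμ (A.indicator 1) (B.indicator 1) (C.indicator 1) (measurable_one.indicator hA)
    (measurable_one.indicator hB) (measurable_one.indicator hC) fun x y => by
      by_cases hx : x ∈ A
      · by_cases hy : y ∈ B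
        · simp [hx, hy, H x hx y hy]
        · simp [hy, hq]
      · simp [hx, hp]
  simpa [lintegral_indicator_one, hA, hB, hC] using this

end PrekopaLeindler

theorem ConcaveOn.exists_le_affine_of_mem_interior {S : Set ℝ} {f : ℝ → ℝ} (hf : ConcaveOn ℝ S f)
    {x : ℝ} (hx : x ∈ interior S) : ∃ s, ∀ y ∈ S, f y ≤ f x + s * (y - x) := by
  refine ⟨-derivWithin (-f) (Set.Ioi x) x, fun y hy => ?_⟩
  rcases lt_trichotomy y x with hyx | rfl | hxy
  · have h1 := (hf.neg.slope_le_leftDeriv_of_mem_interior hy hx hyx).trans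
      (hf.neg.leftDeriv_le_rightDeriv_of_mem_interior hx)
    rw [slope_def_field, div_le_iff₀ (sub_pos.2 hyx)] at h1
    simp only [Pi.neg_apply] at h1
    linarith
  · simp
  · have h1 := hf.neg.rightDeriv_le_slope_of_mem_interior hx hy hxy
    rw [slope_def_field, le_div_iff₀ (sub_pos.2 hxy)] at h1
    simp only [Pi.neg_apply] at h1
    linarith

namespace ProbabilityTheory

variable {P : Measure ℝ} [IsProbabilityMeasure P]

theorem exists_lt_integral_cdf_pos [NullSingletonClass P] (hP : Integrable id P) :
    ∃ t < ∫ x, x ∂P, 0 < cdf P t := by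
  by_contra! h
  have h1 : 0 < P {x | x ≤ ∫ x, x ∂P} := measure_le_integral_pos hP
  have h2 : P (Set.Iio (∫ x, x ∂P)) = 0 := by
    obtain ⟨u, -, hu, hlim⟩ := exists_seq_strictMono_tendsto (∫ x, x ∂P)
    refine measure_mono_null (t := ⋃ n, Set.Iic (u n)) (fun x hx => ?_)
      (measure_iUnion_null fun n => ?_)
    · obtain ⟨n, hn⟩ := (hlim.eventually_const_lt hx).exists
      exact Set.mem_iUnion.2 ⟨n, hn.le⟩
    · have := h _ (hu n)
      rw [cdf_eq_real] at this
      simpa [measureReal_eq_zero_iff] using le_antisymm this measureReal_nonneg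
  rw [measure_congr Iio_ae_eq_Iic] at h2
  exact h1.ne' h2

theorem exp_neg_one_le_cdf_of_cdf_le_exp (hP : Integrable id P) {s : ℝ} (hs : 0 < s)
    {L : ℝ} (h : ∀ t, cdf P t ≤ Real.exp (L + s * (t - ∫ x, x ∂P))) : -1 ≤ L := by
  set m := ∫ x, x ∂P with hm
  set W : ℝ → ℝ := fun x => -(L + s * (x - m)) with hW
  have hWi : Integrable W P :=
    ((integrable_const L).add ((hP.sub (integrable_const m)).const_mul s)).neg
  have hWint : ∫ x, W x ∂P = -L := by
    have h1 : Integrable (fun x : ℝ => x) P := hP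
    simp only [hW]
    have h2 : Integrable (fun x : ℝ => s * (x - m)) P := (h1.sub (integrable_const m)).const_mul s
    rw [integral_neg, integral_add (integrable_const L) h2, integral_const_mul,
      integral_sub h1 (integrable_const m), ← hm]
    simp
  have hlint : ∫⁻ x, ENNReal.ofReal (max (W x) 0) ∂P ≤ ENNReal.ofReal 1 := by
    rw [lintegral_eq_lintegral_meas_le P (f := fun x => max (W x) 0)
        (.of_forall fun x => le_max_right _ _) (by fun_prop),
      ← integral_exp_neg_Ioi_zero,
      ofReal_integral_eq_lintegral_ofReal (integrableOn_exp_neg_Ioi 0)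
        (.of_forall fun x => (Real.exp_pos _).le)]
    refine setLIntegral_mono (by fun_prop) fun t (ht : 0 < t) => ?_
    have hset : {x | t ≤ max (W x) 0} = Set.Iic (m + (-t - L) / s) := by
      ext x
      simp only [Set.mem_ofPred_eq, le_max_iff, not_le.2 ht, or_false, Set.mem_Iic, hW]
      rw [← sub_le_iff_le_add', le_div_iff₀ hs]
      constructor <;> intro h <;> linarith
    rw [hset, ← ofReal_cdf]
    refine ENNReal.ofReal_le_ofReal ((h _).trans_eq ?_)
    congr 1
    field_simp
    ring
  have hle : ∫ x, W x ∂P ≤ 1 := by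
    calc ∫ x, W x ∂P ≤ ∫ x, max (W x) 0 ∂P :=
          integral_mono hWi hWi.pos_part fun x => le_max_left _ _
      _ ≤ 1 := by
          rw [integral_eq_lintegral_of_nonneg_ae (f := fun x => max (W x) 0)
            (.of_forall fun x => le_max_right _ _)
            hWi.pos_part.1]
          exact ENNReal.toReal_le_of_le_ofReal zero_le_one hlint
  linarith

/-- An atomless law on the line with log-concave distribution function gives mass at least `1 / e`
to the half-line below its mean. -/
theorem exp_neg_one_le_cdf_integral [NullSingletonClass P] (hP : Integrable id P)
    (hlc : ∀ p q : ℝ, 0 < p → 0 < q → p + q = 1 → ∀ x y,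
      cdf P x ^ p * cdf P y ^ q ≤ cdf P (p • x + q • y)) :
    Real.exp (-1) ≤ cdf P (∫ x, x ∂P) := by
  obtain ⟨t₀, ht₀, hpos⟩ := exists_lt_integral_cdf_pos hP
  set m := ∫ x, x ∂P with hm
  set S : Set ℝ := {t | 0 < cdf P t} with hS
  have hSub : Set.Ioi t₀ ⊆ S := fun t ht => hpos.trans_le ((cdf P).mono (le_of_lt ht))
  have hmem : m ∈ interior S := interior_mono hSub (by simpa using ht₀)
  have hmpos : 0 < cdf P m := hSub ht₀
  have hconc : ConcaveOn ℝ S fun t => Real.log (cdf P t) := by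
    rw [concaveOn_iff_forall_pos]
    refine ⟨(Set.OrdConnected.mk fun x hx y hy z hz => ?_).convex, ?_⟩
    · exact lt_of_lt_of_le hx ((cdf P).mono hz.1)
    · intro x (hx : 0 < cdf P x) y (hy : 0 < cdf P y) p q hp hq hpq
      have h1 := Real.rpow_pos_of_pos hx p
      have h2 := Real.rpow_pos_of_pos hy q
      have := Real.log_le_log (mul_pos h1 h2) (hlc p q hp hq hpq x y)
      rwa [Real.log_mul h1.ne' h2.ne', Real.log_rpow hx, Real.log_rpow hy] at this
  obtain ⟨s, hs⟩ := hconc.exists_le_affine_of_mem_interior hmem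
  have hbound (t : ℝ) : cdf P t ≤ Real.exp (Real.log (cdf P m) + s * (t - m)) := by
    rcases (cdf_nonneg P t).eq_or_lt with h0 | h0
    · rw [← h0]
      positivity
    · exact (Real.log_le_iff_le_exp h0).1 (hs t h0)
  have hs0 : 0 ≤ s := by
    have h1 := hs (m + 1) (hmpos.trans_le ((cdf P).mono (by linarith)))
    have h2 := Real.log_le_log hmpos ((cdf P).mono (show m ≤ m + 1 by linarith))
    simp only [add_sub_cancel_left, mul_one] at h1
    linarith
  rw [← Real.le_log_iff_exp_le hmpos]
  rcases hs0.eq_or_lt with rfl | hs0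
  · have : 1 ≤ cdf P m := le_of_tendsto' (tendsto_cdf_atTop P) fun t => by
      simpa [Real.exp_log hmpos] using hbound t
    linarith [Real.log_nonneg this]
  · exact exp_neg_one_le_cdf_of_cdf_le_exp hP hs0 hbound

end ProbabilityTheory

theorem measure_preimage_inner_singleton {E : Type*} [NormedAddCommGroup E] [InnerProductSpace ℝ E]
    [MeasurableSpace E] [BorelSpace E] [FiniteDimensional ℝ E] (μ : Measure E) [μ.IsAddHaarMeasure]
    {a : E} (ha : a ≠ 0) (t : ℝ) : μ ((fun x => ⟪a, x⟫) ⁻¹' {t}) = 0 := by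
  have hsurj : Function.Surjective (innerₛₗ ℝ a) :=
    LinearMap.surjective fun h => ha <| by
      simpa using LinearMap.congr_fun h a
  obtain ⟨c, -, hc⟩ :=
    (innerₛₗ ℝ a).exists_map_addHaar_eq_smul_addHaar μ (volume : Measure ℝ) hsurj
  have hmeas : Measurable (innerₛₗ ℝ a) := by
    change Measurable fun x => ⟪a, x⟫
    fun_prop
  have := congr_arg (· {t}) hc
  simp only [Measure.map_apply hmeas (measurableSet_singleton t)] at this
  simpa using this

theorem grunbaum (d : ℕ) (hd : 1 ≤ d) (K : Set (EuclideanSpace ℝ (Fin d)))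
    (hcompact : IsCompact K) (hconv : Convex ℝ K)
    (hpos : 0 < volume K) (a : EuclideanSpace ℝ (Fin d)) (ha : a ≠ 0)
    (c : EuclideanSpace ℝ (Fin d)) (hc : c = ⨍ x in K, x) :
    ENNReal.ofReal (1 / Real.exp 1) * volume K
      ≤ volume (K ∩ {x | ⟪a, x - c⟫ ≤ 0}) := by
  have hK := hcompact.measurableSet
  have hV0 : volume K ≠ 0 := hpos.ne'
  have hVt : volume K ≠ ∞ := hcompact.measure_lt_top.ne
  set Q := ProbabilityTheory.cond volume K with hQ
  have : IsProbabilityMeasure Q := ProbabilityTheory.cond_isProbabilityMeasure_of_finite hV0 hVt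
  have hQid : Integrable (fun x => x) Q := by
    have : IntegrableOn (fun x => x) K := continuousOn_id.integrableOn_compact hcompact
    exact this.smul_measure (ENNReal.inv_ne_top.2 hV0)
  have hm : Measurable fun x : EuclideanSpace ℝ (Fin d) => ⟪a, x⟫ := by fun_prop
  set P := Q.map fun x => ⟪a, x⟫ with hP
  have : IsProbabilityMeasure P := Measure.isProbabilityMeasure_map hm.aemeasurable
  have hPid : Integrable id P := by
    rw [hP, integrable_map_measure (by fun_prop) (by fun_prop)]
    exact hQid.const_inner a
  have hmean : ∫ x, x ∂P = ⟪a, c⟫ := by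
    rw [hP, integral_map (by fun_prop) (by fun_prop), integral_inner hQid, hc, setAverage_eq']
    rfl
  have hPapply {s : Set ℝ} (hs : MeasurableSet s) :
      P s = (volume K)⁻¹ * volume (K ∩ (fun x => ⟪a, x⟫) ⁻¹' s) := by
    rw [hP, Measure.map_apply hm hs, hQ, ProbabilityTheory.cond_apply hK]
  have : NullSingletonClass P := ⟨fun t => by
    rw [hPapply (measurableSet_singleton t),
      measure_mono_null Set.inter_subset_right (measure_preimage_inner_singleton volume ha t),
      mul_zero]⟩
  have hlc (p q : ℝ) (hp : 0 < p) (hq : 0 < q) (hpq : p + q = 1) (x y : ℝ) :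
      ProbabilityTheory.cdf P x ^ p * ProbabilityTheory.cdf P y ^ q ≤
        ProbabilityTheory.cdf P (p • x + q • y) := by
    have hS (t : ℝ) : MeasurableSet (K ∩ (fun x => ⟪a, x⟫) ⁻¹' Set.Iic t) :=
      hK.inter (hm measurableSet_Iic)
    have hBM := (PrekopaLeindler.volume_euclideanSpace hp hq hpq d).measure_rpow_mul_le hp hq
      (hS x) (hS y) (hS (p • x + q • y)) (by
        rintro u ⟨hu, hux⟩ v ⟨hv, hvy⟩
        refine ⟨hconv hu hv hp.le hq.le hpq, ?_⟩
        simp only [Set.mem_preimage, Set.mem_Iic, inner_add_right, inner_smul_right,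
          smul_eq_mul] at hux hvy ⊢
        gcongr)
    have hE : P (Set.Iic x) ^ p * P (Set.Iic y) ^ q ≤ P (Set.Iic (p • x + q • y)) := by
      rw [hPapply measurableSet_Iic, hPapply measurableSet_Iic, hPapply measurableSet_Iic,
        ENNReal.mul_rpow_of_nonneg _ _ hp.le, ENNReal.mul_rpow_of_nonneg _ _ hq.le, mul_mul_mul_comm,
        ← ENNReal.rpow_add_of_nonneg _ _ hp.le hq.le, hpq, ENNReal.rpow_one]
      gcongr
    have := ENNReal.toReal_mono (measure_ne_top P _) hE
    rw [ENNReal.toReal_mul, ← ENNReal.toReal_rpow, ← ENNReal.toReal_rpow] at this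
    simpa only [ProbabilityTheory.cdf_eq_real, measureReal_def] using this
  have key := ENNReal.ofReal_le_ofReal (ProbabilityTheory.exp_neg_one_le_cdf_integral hPid hlc)
  rw [ProbabilityTheory.ofReal_cdf, hmean, hPapply measurableSet_Iic, Real.exp_neg,
    ← one_div] at key
  have hset : {x | ⟪a, x - c⟫ ≤ 0} = (fun x => ⟪a, x⟫) ⁻¹' Set.Iic ⟪a, c⟫ := by
    ext x
    simp [inner_sub_right]
  rw [hset]
  calc ENNReal.ofReal (1 / Real.exp 1) * volume K
      ≤ (volume K)⁻¹ * volume (K ∩ (fun x => ⟪a, x⟫) ⁻¹' Set.Iic ⟪a, c⟫) * volume K := by gcongr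
    _ = volume (K ∩ (fun x => ⟪a, x⟫) ⁻¹' Set.Iic ⟪a, c⟫) := by
        rw [mul_right_comm, ENNReal.inv_mul_cancel hV0 hVt, one_mul]
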